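/- arXiv:1601.06991 — 2 statements merged into one kernel-verified Lean document; each statement's English description precedes it below -/
import Mathlib

section
/- There exists an absolute constant C > 0 such that for every integer n ≥ 1, every real q with 0 < q < 1, and every s ∈ {1,…,n}, if π has the Mallows distribution μ_{n,q}, then E[(max(C_s(π)) − s)²] ≤ C · min{q · ξ⁴, (n−s)²}, where ξ := min{i ∈ ℕ, i ≥ 1 : q^i ≤ 1/2}. -/
open Finset
open scoped Classical BigOperators

noncomputable section

/-- Number of inversions of a permutation of `Fin n` (0-indexed positions). -/
def invCount (n : ℕ) (π : Equiv.Perm (Fin n)) : ℕ :=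
  ((Finset.univ : Finset (Fin n × Fin n)).filter
    (fun p => p.1 < p.2 ∧ π p.2 < π p.1)).card

/-- Normalizing constant of the Mallows distribution. -/
def mallowsZ (n : ℕ) (q : ℝ) : ℝ :=
  ∑ σ : Equiv.Perm (Fin n), q ^ invCount n σ

/-- Mallows probability of an individual permutation. -/
def mallowsP (n : ℕ) (q : ℝ) (π : Equiv.Perm (Fin n)) : ℝ :=
  q ^ invCount n π / mallowsZ n q

/-- Expectation of a real-valued functional under the Mallows distribution. -/
def mExp (n : ℕ) (q : ℝ) (X : Equiv.Perm (Fin n) → ℝ) : ℝ :=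
  ∑ π : Equiv.Perm (Fin n), mallowsP n q π * X π

/-- Probability of an event under the Mallows distribution. -/
def mProb (n : ℕ) (q : ℝ) (A : Equiv.Perm (Fin n) → Prop) : ℝ :=
  ∑ π : Equiv.Perm (Fin n), if A π then mallowsP n q π else 0

/-- Conditional probability of `A` given `B` under the Mallows distribution. -/
def mCondProb (n : ℕ) (q : ℝ) (A B : Equiv.Perm (Fin n) → Prop) : ℝ :=
  mProb n q (fun π => A π ∧ B π) / mProb n q B

/-- The set of points of the cycle of `π` containing `s`. -/
def cycleSet (n : ℕ) (π : Equiv.Perm (Fin n)) (s : Fin n) : Finset (Fin n) :=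
  Finset.univ.filter (fun t => π.SameCycle s t)

lemma self_mem_cycleSet (n : ℕ) (π : Equiv.Perm (Fin n)) (s : Fin n) :
    s ∈ cycleSet n π s :=
  Finset.mem_filter.mpr ⟨Finset.mem_univ _, Equiv.Perm.SameCycle.refl _ _⟩

/-- Maximal element of the cycle of `s`, in 1-indexed labelling `{1,…,n}`. -/
def cycMax (n : ℕ) (π : Equiv.Perm (Fin n)) (s : Fin n) : ℕ :=
  (cycleSet n π s).sup (fun t => (t : ℕ) + 1)

/-- Minimal element of the cycle of `s`, in 1-indexed labelling `{1,…,n}`. -/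
def cycMin (n : ℕ) (π : Equiv.Perm (Fin n)) (s : Fin n) : ℕ :=
  (cycleSet n π s).inf' ⟨s, self_mem_cycleSet n π s⟩ (fun t => (t : ℕ) + 1)


/-- Lehmer code. -/
def cd {n : ℕ} (π : Equiv.Perm (Fin n)) (t : Fin n) : ℕ :=
  ((univ : Finset (Fin n)).filter (fun r => t < r ∧ π r < π t)).card

lemma inv_eq_sum {n : ℕ} (π : Equiv.Perm (Fin n)) : invCount n π = ∑ t, cd π t := by
  unfold invCount cd
  rw [Finset.card_eq_sum_card_fiberwise (f := Prod.fst) (t := univ) (by intro x _; simp)]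
  refine Finset.sum_congr rfl fun t _ => ?_
  refine Finset.card_bij' (fun p _ => p.2) (fun r _ => (t, r)) ?_ ?_ ?_ ?_
  · rintro ⟨a, b⟩ h
    simp at h ⊢
    obtain ⟨h, rfl⟩ := h
    exact h
  · intro r h
    simpa using h
  · rintro ⟨a, b⟩ h
    simp at h ⊢
    exact h.2.symm
  · intro r h
    rfl

lemma inv_symm {n : ℕ} (π : Equiv.Perm (Fin n)) : invCount n π⁻¹ = invCount n π := by
  unfold invCount
  refine Finset.card_bij' (fun p _ => (π⁻¹ p.2, π⁻¹ p.1)) (fun p _ => (π p.2, π p.1)) ?_ ?_ ?_ ?_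
  · rintro ⟨a, b⟩ h
    simp at h ⊢
    exact ⟨h.2, h.1⟩
  · rintro ⟨a, b⟩ h
    simp at h ⊢
    exact ⟨h.2, h.1⟩
  · rintro ⟨a, b⟩ h
    simp
  · rintro ⟨a, b⟩ h
    simp

lemma cd_lt {n : ℕ} (π : Equiv.Perm (Fin n)) (t : Fin n) : cd π t < n - t := by
  unfold cd
  have : ((univ : Finset (Fin n)).filter (fun r => t < r ∧ π r < π t)).card ≤ (Finset.Ioi t).card := by
    apply Finset.card_le_card
    intro r; simp; intro h _; exact h
  rw [Fin.card_Ioi] at this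
  have := t.2
  omega

lemma cd_eq {n : ℕ} (π : Equiv.Perm (Fin n)) (t : Fin n) :
    cd π t = ((univ : Finset (Fin n)).filter (fun v => v < π t ∧ ∀ r < t, π r ≠ v)).card := by
  unfold cd
  refine Finset.card_bij' (fun r _ => π r) (fun v _ => π⁻¹ v) ?_ ?_ ?_ ?_
  · intro r h
    simp at h ⊢
    refine ⟨h.2, fun r' hr' e => ?_⟩
    subst e
    exact absurd hr' (not_lt.2 h.1.le)
  · intro v h
    simp at h ⊢
    refine ⟨?_, h.1⟩
    rcases lt_trichotomy t (π⁻¹ v) with h1 | h1 | h1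
    · exact h1
    · exfalso; have := h.1; rw [h1] at this; simp at this
    · exact absurd (by simp) (h.2 _ h1)
  · intro r h; simp
  · intro r h; simp

lemma rows_eq {n : ℕ} (π π' : Equiv.Perm (Fin n)) (t : ℕ)
    (h : ∀ r : Fin n, (r : ℕ) < t → cd π r = cd π' r) :
    ∀ r : Fin n, (r : ℕ) < t → π r = π' r := by
  intro r
  induction r using WellFoundedLT.induction with
  | _ r ih =>
    intro hr
    have h1 : ∀ r' < r, π r' = π' r' := fun r' hr' => ih r' hr' (lt_trans hr' hr)
    have h2 := h r hr
    rw [cd_eq, cd_eq] at h2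
    have key : ∀ (σ τ : Equiv.Perm (Fin n)), (∀ r' < r, σ r' = τ r') → σ r < τ r →
       ((univ : Finset (Fin n)).filter (fun v => v < σ r ∧ ∀ r' < r, σ r' ≠ v)).card <
       ((univ : Finset (Fin n)).filter (fun v => v < τ r ∧ ∀ r' < r, τ r' ≠ v)).card := by
      intro σ τ hs hlt
      apply Finset.card_lt_card
      rw [Finset.ssubset_iff_of_subset]
      · refine ⟨σ r, ?_, ?_⟩
        · simp
          refine ⟨hlt, fun r' hr' e => ?_⟩
          rw [← hs r' hr'] at e
          exact hr'.ne (σ.injective e)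
        · simp
      · intro v; simp
        intro h3 h4
        exact ⟨h3.trans hlt, fun r' hr' => by rw [← hs r' hr']; exact h4 r' hr'⟩
    rcases lt_trichotomy (π r) (π' r) with h3 | h3 | h3
    · have := key π π' h1 h3; omega
    · exact h3
    · have := key π' π (fun r' hr' => (h1 r' hr').symm) h3; omega

def codeMap (n : ℕ) (π : Equiv.Perm (Fin n)) : (i : Fin n) → Fin (n - i) :=
  fun i => ⟨cd π i, cd_lt π i⟩

lemma codeMap_bij (n : ℕ) : Function.Bijective (codeMap n) := by
  rw [Fintype.bijective_iff_injective_and_card]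
  constructor
  · intro π π' h
    ext r
    rw [rows_eq π π' n (fun r _ => ?_) r r.2]
    have := congrFun h r
    simpa [codeMap] using this
  · rw [Fintype.card_perm, Fintype.card_pi]
    simp only [Fintype.card_fin]
    rw [Fin.prod_univ_eq_prod_range (fun i => n - i) n, ← Nat.descFactorial_eq_prod_range,
      Nat.descFactorial_self]

/-- weighted sum of a predicate -/
def WS {n : ℕ} (q : ℝ) (P : Equiv.Perm (Fin n) → Prop) : ℝ :=
  ∑ π : Equiv.Perm (Fin n), if P π then q ^ invCount n π else 0

lemma WS_filter {n : ℕ} (q : ℝ) (P : Equiv.Perm (Fin n) → Prop) :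
    WS q P = ∑ π ∈ univ.filter P, q ^ invCount n π := by
  rw [WS, Finset.sum_filter]

lemma exists_update {n : ℕ} (π : Equiv.Perm (Fin n)) (t : Fin n) (j : ℕ) (hj : j < n - t) :
    ∃ π' : Equiv.Perm (Fin n), cd π' t = j ∧ ∀ r ≠ t, cd π' r = cd π r := by
  obtain ⟨π', h⟩ := (codeMap_bij n).2 (Function.update (codeMap n π) t ⟨j, hj⟩)
  refine ⟨π', ?_, fun r hr => ?_⟩
  · have := congrFun h t
    simp [codeMap] at this
    exact this
  · have := congrFun h r
    rw [Function.update_of_ne hr] at this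
    simpa [codeMap] using this

lemma cd_inj {n : ℕ} (π π' : Equiv.Perm (Fin n)) (h : ∀ r, cd π r = cd π' r) : π = π' := by
  ext r; rw [rows_eq π π' n (fun r _ => h r) r r.2]

lemma WS_cd_swap {n : ℕ} (q : ℝ) (t : Fin n) (P : Equiv.Perm (Fin n) → Prop)
    (hP : ∀ π π' : Equiv.Perm (Fin n), (∀ r < t, π r = π' r) → P π → P π')
    (j j' : ℕ) (hj : j < n - t) (hj' : j' < n - t) :
    q ^ j * WS q (fun π => P π ∧ cd π t = j') = q ^ j' * WS q (fun π => P π ∧ cd π t = j) := by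
  rw [WS_filter, WS_filter]
  rw [Finset.mul_sum, Finset.mul_sum]
  choose F hF1 hF2 using fun (π : Equiv.Perm (Fin n)) (j : Fin (n - t)) => exists_update π t j j.2
  have hFP : ∀ π j, P π → P (F π j) := by
    intro π j h
    refine hP _ _ ?_ h
    have := rows_eq π (F π j) t (fun r hr => (hF2 π j r (by intro e; subst e; omega)).symm)
    exact this
  refine Finset.sum_bij' (fun π _ => F π ⟨j, hj⟩) (fun π _ => F π ⟨j', hj'⟩) ?_ ?_ ?_ ?_ ?_
  · intro π h
    simp at h ⊢
    exact ⟨hFP _ _ h.1, hF1 _ _⟩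
  · intro π h
    simp at h ⊢
    exact ⟨hFP _ _ h.1, hF1 _ _⟩
  · intro π h
    simp at h
    apply cd_inj
    intro r
    by_cases hr : r = t
    · subst hr; rw [hF1, h.2]
    · rw [hF2 _ _ _ hr, hF2 _ _ _ hr]
  · intro π h
    simp at h
    apply cd_inj
    intro r
    by_cases hr : r = t
    · subst hr; rw [hF1, h.2]
    · rw [hF2 _ _ _ hr, hF2 _ _ _ hr]
  · intro π h
    simp at h
    rw [← pow_add, ← pow_add]
    congr 1
    rw [inv_eq_sum, inv_eq_sum, ← Finset.add_sum_erase univ _ (mem_univ t),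
      ← Finset.add_sum_erase univ (fun r => cd (F π ⟨j, hj⟩) r) (mem_univ t), hF1, h.2]
    have : ∑ x ∈ univ.erase t, cd (F π ⟨j, hj⟩) x = ∑ x ∈ univ.erase t, cd π x :=
      Finset.sum_congr rfl fun x hx => hF2 _ _ _ (Finset.ne_of_mem_erase hx)
    rw [this]
    simp only
    omega

/-- q-integer -/
def qi (q : ℝ) (k : ℕ) : ℝ := ∑ j ∈ range k, q ^ j

lemma WS_cd_eq {n : ℕ} (q : ℝ) (t : Fin n) (P : Equiv.Perm (Fin n) → Prop)
    (hP : ∀ π π' : Equiv.Perm (Fin n), (∀ r < t, π r = π' r) → P π → P π')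
    (j : ℕ) (hj : j < n - t) :
    qi q (n - t) * WS q (fun π => P π ∧ cd π t = j) = q ^ j * WS q P := by
  unfold qi
  rw [Finset.sum_mul]
  rw [Finset.sum_congr rfl (fun j' hj' => WS_cd_swap q t P hP j' j (by simpa using hj') hj),
    ← Finset.mul_sum]
  congr 1
  unfold WS
  rw [Finset.sum_comm]
  refine Finset.sum_congr rfl fun π _ => ?_
  by_cases h : P π
  · simp [h, cd_lt]
  · simp [h]

lemma WS_cd_lt {n : ℕ} (q : ℝ) (t : Fin n) (P : Equiv.Perm (Fin n) → Prop)
    (hP : ∀ π π' : Equiv.Perm (Fin n), (∀ r < t, π r = π' r) → P π → P π')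
    (k : ℕ) (hk : k ≤ n - t) :
    qi q (n - t) * WS q (fun π => P π ∧ cd π t < k) = qi q k * WS q P := by
  have : WS q (fun π => P π ∧ cd π t < k) = ∑ j ∈ range k, WS q (fun π => P π ∧ cd π t = j) := by
    unfold WS
    rw [Finset.sum_comm]
    refine Finset.sum_congr rfl fun π _ => ?_
    by_cases h : P π
    · simp [h]
    · simp [h]
  rw [this, Finset.mul_sum]
  rw [Finset.sum_congr rfl (fun j hj => WS_cd_eq q t P hP j (by simp at hj; omega)),
    ← Finset.sum_mul]
  rfl

/-- number of rows at least `t` with values less than `v` -/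
def NN {n : ℕ} (t v : ℕ) (π : Equiv.Perm (Fin n)) : ℕ :=
  ((univ : Finset (Fin n)).filter (fun r : Fin n => t ≤ (r : ℕ) ∧ (π r : ℕ) < v)).card

lemma NN_le {n : ℕ} (t v : ℕ) (π : Equiv.Perm (Fin n)) : NN t v π ≤ n - t := by
  by_cases h : t < n
  · unfold NN
    calc _ ≤ (Finset.Ici (⟨t, h⟩ : Fin n)).card := by
          apply Finset.card_le_card
          intro r; simp; intro h _; exact h
      _ = n - t := by rw [Fin.card_Ici]
  · unfold NN
    rw [Finset.filter_false_of_mem]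
    · simp
    · intro r _ ; have := r.2; omega

lemma lt_iff_cd {n : ℕ} (t : Fin n) (v : ℕ) (π : Equiv.Perm (Fin n)) :
    (π t : ℕ) < v ↔ cd π t < NN t v π := by
  constructor
  · intro h
    apply Finset.card_lt_card
    rw [Finset.ssubset_iff_of_subset]
    · exact ⟨t, by simpa using h, by simp⟩
    · intro r; simp only [mem_filter, mem_univ, true_and]
      rintro ⟨h1, h2⟩
      exact ⟨h1.le, lt_trans h2 h⟩
  · intro h
    by_contra h1
    push Not at h1
    refine absurd h (not_lt.2 (Finset.card_le_card ?_))
    intro r; simp only [mem_filter, mem_univ, true_and]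
    rintro ⟨h2, h3⟩
    have h4 : π r < π t := Fin.lt_def.2 (by omega)
    refine ⟨lt_of_le_of_ne h2 ?_, h4⟩
    rintro rfl
    exact lt_irrefl _ h4

lemma WS_row {n : ℕ} (q : ℝ) (t : Fin n) (P : Equiv.Perm (Fin n) → Prop)
    (hP : ∀ π π' : Equiv.Perm (Fin n), (∀ r < t, π r = π' r) → P π → P π')
    (v k : ℕ) (hk : ∀ π, P π → NN t v π = k) :
    qi q (n - t) * WS q (fun π => P π ∧ (π t : ℕ) < v) = qi q k * WS q P := by
  by_cases hkn : k ≤ n - t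
  · rw [← WS_cd_lt q t P hP k hkn]
    congr 2
    funext π
    by_cases h : P π
    · simp [h, lt_iff_cd, hk π h]
    · simp [h]
  · have : ∀ π, ¬ P π := by
      intro π h
      have := NN_le t v π
      rw [hk π h] at this
      exact hkn this
    simp [WS, this]

lemma WS_inv {n : ℕ} (q : ℝ) (P : Equiv.Perm (Fin n) → Prop) :
    WS q (fun π => P π⁻¹) = WS q P := by
  unfold WS
  rw [← Equiv.sum_comp (Equiv.inv (Equiv.Perm (Fin n)))]
  refine Finset.sum_congr rfl fun π _ => ?_
  simp [inv_symm]

lemma WS_col {n : ℕ} (q : ℝ) (t : Fin n) (P : Equiv.Perm (Fin n) → Prop)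
    (hP : ∀ π π' : Equiv.Perm (Fin n), (∀ r < t, π⁻¹ r = π'⁻¹ r) → P π → P π')
    (v k : ℕ) (hk : ∀ π, P π → NN t v π⁻¹ = k) :
    qi q (n - t) * WS q (fun π => P π ∧ (π⁻¹ t : ℕ) < v) = qi q k * WS q P := by
  have := WS_row q t (fun π => P π⁻¹) (fun π π' h h1 => hP π⁻¹ π'⁻¹ (by simpa using h) h1) v k
    (fun π h => by simpa using hk _ h)
  rw [WS_inv] at this
  rw [← this, ← WS_inv]
  simp

/-- The restriction of a permutation to the square `[0,t)²`, as a relation. -/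
def RR {n : ℕ} (t : ℕ) (π : Equiv.Perm (Fin n)) : Fin n → Fin n → Prop :=
  fun x y => (x : ℕ) < t ∧ (y : ℕ) < t ∧ π x = y

lemma RR_row {n : ℕ} (t : ℕ) (π π' : Equiv.Perm (Fin n))
    (h : ∀ r : Fin n, (r : ℕ) < t → π r = π' r) : RR t π = RR t π' := by
  funext x y
  simp only [RR, eq_iff_iff]
  constructor
  · rintro ⟨h1, h2, h3⟩; exact ⟨h1, h2, by rw [← h x h1, h3]⟩
  · rintro ⟨h1, h2, h3⟩; exact ⟨h1, h2, by rw [h x h1, h3]⟩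

lemma RR_inv {n : ℕ} (t : ℕ) (π : Equiv.Perm (Fin n)) (x y : Fin n) :
    RR t π⁻¹ x y ↔ RR t π y x := by
  simp only [RR]
  constructor
  · rintro ⟨h1, h2, h3⟩; exact ⟨h2, h1, by rw [← h3]; simp⟩
  · rintro ⟨h1, h2, h3⟩; exact ⟨h2, h1, by rw [← h3]; simp⟩

lemma RR_col {n : ℕ} (t : ℕ) (π π' : Equiv.Perm (Fin n))
    (h : ∀ r : Fin n, (r : ℕ) < t → π⁻¹ r = π'⁻¹ r) : RR t π = RR t π' := by
  have := RR_row t π⁻¹ π'⁻¹ h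
  funext x y
  rw [eq_iff_iff, ← RR_inv t π, ← RR_inv t π', this]

/-- number of open columns below `v` -/
def openCol {n : ℕ} (R : Fin n → Fin n → Prop) (v : ℕ) : ℕ :=
  ((univ : Finset (Fin n)).filter (fun c : Fin n => (c : ℕ) < v ∧ ∀ y, ¬ R y c)).card

lemma NN_eq {n : ℕ} (t v : ℕ) (hv : v ≤ t) (π : Equiv.Perm (Fin n)) :
    NN t v π = openCol (RR t π) v := by
  unfold NN openCol
  refine Finset.card_bij' (fun r _ => π r) (fun v _ => π⁻¹ v) ?_ ?_ ?_ ?_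
  · intro r h
    simp [RR] at h ⊢
    refine ⟨h.2, fun y h1 h2 e => ?_⟩
    subst e; omega
  · intro c h
    simp [RR] at h ⊢
    refine ⟨?_, h.1⟩
    by_contra h3
    exact h.2 (π.symm c) (by omega) (by omega) (by simp)
  · intro r h; simp
  · intro r h; simp

lemma NN_inv_eq {n : ℕ} (t v : ℕ) (hv : v ≤ t) (π : Equiv.Perm (Fin n)) :
    NN t v π⁻¹ = openCol (fun x y => RR t π y x) v := by
  rw [NN_eq t v hv]
  congr 1
  funext x y
  rw [eq_iff_iff, RR_inv]

lemma openCol_succ {n : ℕ} (R : Fin n → Fin n → Prop) (b : Fin n) (hb : ∀ y, ¬ R y b) :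
    openCol R (b + 1) = openCol R b + 1 := by
  unfold openCol
  rw [← Finset.card_insert_of_notMem (a := b) (by simp)]
  congr 1
  ext c
  simp only [mem_filter, mem_univ, true_and, mem_insert]
  constructor
  · rintro ⟨h1, h2⟩
    by_cases h : c = b
    · exact Or.inl h
    · refine Or.inr ⟨?_, h2⟩
      have : (c : ℕ) ≠ b := fun e => h (Fin.ext e)
      omega
  · rintro (rfl | ⟨h1, h2⟩)
    · exact ⟨by omega, hb⟩
    · exact ⟨by omega, h2⟩

lemma openCol_mono {n : ℕ} (R : Fin n → Fin n → Prop) {v w : ℕ} (h : v ≤ w) :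
    openCol R v ≤ openCol R w := by
  unfold openCol
  apply Finset.card_le_card
  intro c; simp only [mem_filter, mem_univ, true_and]
  rintro ⟨h1, h2⟩
  exact ⟨by omega, h2⟩

lemma NN_self_inv {n : ℕ} (t : ℕ) (π : Equiv.Perm (Fin n)) : NN t t π⁻¹ = NN t t π := by
  have h1 : NN t t π⁻¹ = ((univ : Finset (Fin n)).filter (fun r : Fin n => (r : ℕ) < t ∧ ¬ (π r : ℕ) < t)).card := by
    unfold NN
    refine Finset.card_bij' (fun r _ => π⁻¹ r) (fun v _ => π v) ?_ ?_ ?_ ?_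
    · intro r h
      simp at h ⊢
      exact ⟨h.2, h.1⟩
    · intro c h
      simp at h ⊢
      exact ⟨h.2, h.1⟩
    · intro r h; simp
    · intro r h; simp
  have h2 : NN t t π = ((univ : Finset (Fin n)).filter (fun r : Fin n => (π r : ℕ) < t ∧ ¬ (r : ℕ) < t)).card := by
    unfold NN
    congr 1
    ext r; simp; tauto
  have h3 : ((univ : Finset (Fin n)).filter (fun r : Fin n => (r : ℕ) < t)).card
     = ((univ : Finset (Fin n)).filter (fun r : Fin n => (π r : ℕ) < t)).card := by
    refine Finset.card_bij' (fun r _ => π⁻¹ r) (fun v _ => π v) ?_ ?_ ?_ ?_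
    · intro r h; simpa using h
    · intro r h; simpa using h
    · intro r h; simp
    · intro r h; simp
  have h4 := Finset.card_filter_add_card_filter_not (s := (univ : Finset (Fin n)).filter (fun r : Fin n => (r : ℕ) < t)) (fun r => (π r : ℕ) < t)
  have h5 := Finset.card_filter_add_card_filter_not (s := (univ : Finset (Fin n)).filter (fun r : Fin n => (π r : ℕ) < t)) (fun r => (r : ℕ) < t)
  rw [Finset.filter_filter, Finset.filter_filter] at h4 h5
  have h6 : ((univ : Finset (Fin n)).filter (fun r : Fin n => (r : ℕ) < t ∧ (π r : ℕ) < t))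
     = ((univ : Finset (Fin n)).filter (fun r : Fin n => (π r : ℕ) < t ∧ (r : ℕ) < t)) := by
    ext r; simp; tauto
  rw [h6] at h4
  omega

lemma NN_succ_row {n : ℕ} (t : Fin n) (v : ℕ) (π : Equiv.Perm (Fin n)) :
    NN t v π = NN (t + 1) v π + if (π t : ℕ) < v then 1 else 0 := by
  unfold NN
  split_ifs with h
  · rw [← Finset.card_insert_of_notMem (a := t) (by simp)]
    congr 1
    ext r
    simp only [mem_filter, mem_univ, true_and, mem_insert]
    constructor
    · rintro ⟨h1, h2⟩
      by_cases h : r = t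
      · exact Or.inl h
      · have : (r : ℕ) ≠ t := fun e => h (Fin.ext e)
        exact Or.inr ⟨by omega, h2⟩
    · rintro (rfl | ⟨h1, h2⟩)
      · exact ⟨le_rfl, h⟩
      · exact ⟨by omega, h2⟩
  · rw [add_zero]
    congr 1
    ext r
    simp only [mem_filter, mem_univ, true_and]
    constructor
    · rintro ⟨h1, h2⟩
      have : (r : ℕ) ≠ t := fun e => by
        have := Fin.ext e
        subst this
        exact h h2
      exact ⟨by omega, h2⟩
    · rintro ⟨h1, h2⟩
      exact ⟨by omega, h2⟩

lemma NN_succ_col {n : ℕ} (t : Fin n) (π : Equiv.Perm (Fin n)) :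
    NN t (t + 1) π = NN t t π + if (π⁻¹ t : ℕ) < t then 0 else 1 := by
  unfold NN
  split_ifs with h
  · rw [add_zero]
    congr 1
    ext r
    simp only [mem_filter, mem_univ, true_and]
    constructor
    · rintro ⟨h1, h2⟩
      have : (π r : ℕ) ≠ t := fun e => by
        have := Fin.ext e
        rw [← this] at h
        simp at h
        omega
      exact ⟨by omega, by omega⟩
    · rintro ⟨h1, h2⟩
      exact ⟨by omega, by omega⟩
  · rw [← Finset.card_insert_of_notMem (a := π⁻¹ t) (by simp)]
    congr 1
    ext r
    simp only [mem_filter, mem_univ, true_and, mem_insert]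
    constructor
    · rintro ⟨h1, h2⟩
      by_cases h : r = π⁻¹ t
      · exact Or.inl h
      · have : (π r : ℕ) ≠ t := fun e => h (by rw [← Fin.ext e]; simp)
        exact Or.inr ⟨by omega, by omega⟩
    · rintro (rfl | ⟨h1, h2⟩)
      · exact ⟨by omega, by simp⟩
      · exact ⟨by omega, by omega⟩

/-- cycle of `s` reaches `t` or above -/
def Alive {n : ℕ} (s : Fin n) (t : ℕ) (π : Equiv.Perm (Fin n)) : Prop :=
  ∃ u : Fin n, π.SameCycle s u ∧ t ≤ (u : ℕ)

lemma closed_cycle {n : ℕ} (π : Equiv.Perm (Fin n)) (S : Fin n → Prop) (s u : Fin n) (hs : S s)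
    (h : ∀ x, S x → S (π x)) (hu : π.SameCycle s u) : S u := by
  obtain ⟨i, hi, _, rfl⟩ := hu.exists_pow_eq
  clear hi hu
  have : ∀ j : ℕ, S ((π ^ j) s) := by
    intro j
    induction j with
    | zero => simpa using hs
    | succ j ih => rw [pow_succ', Equiv.Perm.mul_apply]; exact h _ ih
  exact this _

lemma RTG_lt {n : ℕ} {t : ℕ} {π : Equiv.Perm (Fin n)} {s a : Fin n} (hs : (s : ℕ) < t)
    (h : Relation.ReflTransGen (RR t π) s a) : (a : ℕ) < t := by
  induction h with
  | refl => exact hs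
  | tail _ h _ => exact h.2.1

lemma RTG_same {n : ℕ} {t : ℕ} {π : Equiv.Perm (Fin n)} {s a : Fin n}
    (h : Relation.ReflTransGen (RR t π) s a) : π.SameCycle s a := by
  induction h with
  | refl => exact Equiv.Perm.SameCycle.refl _ _
  | tail _ h ih => rw [← h.2.2]; exact Equiv.Perm.sameCycle_apply_right.2 ih

lemma alive_iff {n : ℕ} (s : Fin n) (t : ℕ) (hs : (s : ℕ) < t) (π : Equiv.Perm (Fin n)) :
    Alive s t π ↔ ∃ a, Relation.ReflTransGen (RR t π) s a ∧ ∀ y, ¬ RR t π a y := by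
  constructor
  · rintro ⟨u, hu, hut⟩
    by_contra hcon
    push Not at hcon
    have := closed_cycle π (fun x => Relation.ReflTransGen (RR t π) s x) s u .refl ?_ hu
    · have := RTG_lt hs this; omega
    · intro x hx
      obtain ⟨y, hy⟩ := hcon x hx
      refine hx.tail ?_
      rw [hy.2.2]; exact hy
  · rintro ⟨a, ha, hay⟩
    refine ⟨π a, Equiv.Perm.sameCycle_apply_right.2 (RTG_same ha), ?_⟩
    by_contra h
    exact hay (π a) ⟨RTG_lt hs ha, by omega, rfl⟩

lemma alive_inv {n : ℕ} (s : Fin n) (t : ℕ) (π : Equiv.Perm (Fin n)) :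
    Alive s t π⁻¹ ↔ Alive s t π := by
  unfold Alive
  simp only [Equiv.Perm.sameCycle_inv]

lemma alive_back {n : ℕ} (s : Fin n) (t : ℕ) (hs : (s : ℕ) < t) (π : Equiv.Perm (Fin n))
    (h : Alive s t π) : ∃ b, Relation.ReflTransGen (RR t π) b s ∧ ∀ y, ¬ RR t π y b := by
  rw [← alive_inv, alive_iff s t hs] at h
  obtain ⟨b, hb, hby⟩ := h
  refine ⟨b, ?_, fun y hy => hby y ((RR_inv _ _ _ _).2 hy)⟩
  rw [← Relation.reflTransGen_swap]
  exact Relation.ReflTransGen.mono (fun x y h => (RR_inv _ _ _ _).1 h) _ _ hb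

lemma kill {n : ℕ} (s t : Fin n) (hs : (s : ℕ) < t) (π : Equiv.Perm (Fin n)) (a b : Fin n)
    (ha : Relation.ReflTransGen (RR t π) s a) (ha' : ∀ y, ¬ RR t π a y)
    (hb : Relation.ReflTransGen (RR t π) b s) 
    (h1 : π t = b) (h2 : π a = t) : ¬ Alive s (t + 1) π := by
  rintro ⟨u, hu, hut⟩
  have hbt : (b : ℕ) < t := by
    rcases Relation.ReflTransGen.cases_head hb with h | ⟨c, h, _⟩
    · rw [h]; exact hs
    · exact h.1
  have := closed_cycle π (fun x => Relation.ReflTransGen (RR t π) b x ∨ x = t) s u (Or.inl hb) ?_ hu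
  · rcases this with h | h
    · have := RTG_lt hbt h; omega
    · subst h; omega
  · rintro x (hx | rfl)
    · by_cases hy : ∃ y, RR t π x y
      · obtain ⟨y, hy⟩ := hy
        left
        refine hx.tail ?_
        rw [hy.2.2]; exact hy
      · right
        have hu : Relator.RightUnique (RR (t : ℕ) π) := by
          intro x y z h1 h2
          rw [← h1.2.2, ← h2.2.2]
        have hxa : x = a := by
          rcases Relation.ReflTransGen.total_of_right_unique hu hx (hb.trans ha) with h | h
          · rcases Relation.ReflTransGen.cases_head h with h | ⟨c, h, _⟩
            · exact h
            · exact absurd ⟨c, h⟩ hy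
          · rcases Relation.ReflTransGen.cases_head h with h | ⟨c, h, _⟩
            · exact h.symm
            · exact absurd h (ha' c)
        rw [hxa, h2]
    · left; rw [h1]

lemma WS_congr {n : ℕ} (q : ℝ) (P Q : Equiv.Perm (Fin n) → Prop) (h : ∀ π, P π ↔ Q π) :
    WS q P = WS q Q := by
  have : P = Q := by funext π; exact propext (h π)
  rw [this]

lemma WS_split {n : ℕ} (q : ℝ) (P Q : Equiv.Perm (Fin n) → Prop) :
    WS q (fun π => P π ∧ Q π) + WS q (fun π => P π ∧ ¬ Q π) = WS q P := by
  unfold WS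
  rw [← Finset.sum_add_distrib]
  refine Finset.sum_congr rfl fun π _ => ?_
  by_cases h : P π <;> by_cases h' : Q π <;> simp [h, h']

lemma WS_nonneg {n : ℕ} (q : ℝ) (hq : 0 < q) (P : Equiv.Perm (Fin n) → Prop) : 0 ≤ WS q P := by
  unfold WS
  apply Finset.sum_nonneg
  intro π _
  split_ifs
  · positivity
  · exact le_rfl

lemma qi_succ (q : ℝ) (k : ℕ) : qi q (k + 1) = qi q k + q ^ k := by
  unfold qi; rw [Finset.sum_range_succ]

lemma qi_geom (q : ℝ) (k : ℕ) : (1 - q) * qi q k = 1 - q ^ k := by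
  induction k with
  | zero => simp [qi]
  | succ k ih => rw [qi_succ, mul_add, ih]; ring

lemma qi_pos (q : ℝ) (hq : 0 < q) (k : ℕ) (hk : 0 < k) : 0 < qi q k := by
  unfold qi
  apply Finset.sum_pos
  · intro i _; positivity
  · simpa using hk.ne'

lemma qi_nonneg (q : ℝ) (hq : 0 < q) (k : ℕ) : 0 ≤ qi q k := by
  unfold qi
  apply Finset.sum_nonneg
  intro i _; positivity

lemma WS_row_eq {n : ℕ} (q : ℝ) (t : Fin n) (P : Equiv.Perm (Fin n) → Prop)
    (hP : ∀ π π' : Equiv.Perm (Fin n), (∀ r < t, π r = π' r) → P π → P π')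
    (b : Fin n) (j : ℕ) (h1 : ∀ π, P π → NN t b π = j) (h2 : ∀ π, P π → NN t (b + 1) π = j + 1) :
    qi q (n - t) * WS q (fun π => P π ∧ π t = b) = q ^ j * WS q P := by
  have e1 := WS_row q t P hP b j h1
  have e2 := WS_row q t P hP (b + 1) (j + 1) h2
  have e3 := WS_split q (fun π => P π ∧ (π t : ℕ) < b + 1) (fun π => (π t : ℕ) < b)
  rw [WS_congr q (fun π => (P π ∧ (π t : ℕ) < b + 1) ∧ (π t : ℕ) < b)
      (fun π => P π ∧ (π t : ℕ) < b) (fun π => by constructor <;> (intro h; refine ⟨?_, ?_⟩ <;> first | exact h.1.1 | exact h.2 | exact ⟨h.1, by omega⟩)),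
    WS_congr q (fun π => (P π ∧ (π t : ℕ) < b + 1) ∧ ¬ (π t : ℕ) < b)
      (fun π => P π ∧ π t = b) (fun π => by
        rw [Fin.ext_iff]
        constructor
        · rintro ⟨⟨h, h'⟩, h''⟩; exact ⟨h, by omega⟩
        · rintro ⟨h, h'⟩; exact ⟨⟨h, by omega⟩, by omega⟩)] at e3
  rw [← e3, qi_succ] at e2
  linarith

lemma WS_col_eq {n : ℕ} (q : ℝ) (t : Fin n) (P : Equiv.Perm (Fin n) → Prop)
    (hP : ∀ π π' : Equiv.Perm (Fin n), (∀ r < t, π⁻¹ r = π'⁻¹ r) → P π → P π')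
    (b : Fin n) (j : ℕ) (h1 : ∀ π, P π → NN t b π⁻¹ = j)
    (h2 : ∀ π, P π → NN t (b + 1) π⁻¹ = j + 1) :
    qi q (n - t) * WS q (fun π => P π ∧ π⁻¹ t = b) = q ^ j * WS q P := by
  have := WS_row_eq q t (fun π => P π⁻¹) (fun π π' h h1 => hP π⁻¹ π'⁻¹ (by simpa using h) h1) b j
    (fun π h => by simpa using h1 _ h) (fun π h => by simpa using h2 _ h)
  rw [WS_inv] at this
  rw [← this, ← WS_inv]
  simp

lemma kill_weight {n : ℕ} (q : ℝ) (t : Fin n) (R0 : Fin n → Fin n → Prop) (a b : Fin n)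
    (hat : (a : ℕ) < t) (hbt : (b : ℕ) < t) (ha : ∀ y, ¬ R0 a y) (hb : ∀ y, ¬ R0 y b) :
    qi q (n - t) ^ 2 * WS q (fun π => (RR t π = R0 ∧ π t = b) ∧ π⁻¹ t = a) =
      q ^ (openCol R0 b + openCol (fun x y => R0 y x) a) * WS q (fun π => RR t π = R0) := by
  have e1 := WS_row_eq q t (fun π => RR t π = R0)
    (fun π π' h h1 => by rw [← h1]; exact (RR_row _ _ _ h).symm) b (openCol R0 b)
    (fun π h => by rw [NN_eq _ _ hbt.le, h])
    (fun π h => by rw [NN_eq _ _ hbt, h, openCol_succ _ _ hb])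
  have e2 := WS_col_eq q t (fun π => RR t π = R0 ∧ π t = b)
    (fun π π' h h1 => by
      refine ⟨by rw [← h1.1]; exact (RR_col _ _ _ h).symm, ?_⟩
      have := h b hbt
      rw [← h1.2] at this
      rw [Equiv.Perm.eq_inv_iff_eq.symm, ← h1.2, ← this]
      simp) a (openCol (fun x y => R0 y x) a)
    (fun π h => by rw [NN_inv_eq _ _ hat.le, h.1])
    (fun π h => by rw [NN_inv_eq _ _ hat, h.1, openCol_succ _ _ ha])
  rw [sq, mul_assoc, e2, pow_add]
  linear_combination (q ^ openCol (fun x y => R0 y x) a) * e1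

lemma drift {n : ℕ} (q : ℝ) (hq : 0 < q) (hq1 : q < 1) (t : Fin n) (R0 : Fin n → Fin n → Prop)
    (k : ℕ) (hk : ∀ π : Equiv.Perm (Fin n), RR t π = R0 → NN t t π = k) :
    (∑ π : Equiv.Perm (Fin n), if RR t π = R0 then
        q ^ invCount n π * q⁻¹ ^ (NN (t + 1) (t + 1) π) else 0) ≤
      WS q (fun π : Equiv.Perm (Fin n) => RR t π = R0) * (q⁻¹ ^ k + (1 - q) * (2 - q⁻¹ ^ k)) := by
  set W := WS q (fun π : Equiv.Perm (Fin n) => RR t π = R0) with hW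
  set WD := WS q (fun π : Equiv.Perm (Fin n) => RR t π = R0 ∧ (π⁻¹ t : ℕ) < t) with hWD
  set WD' := WS q (fun π : Equiv.Perm (Fin n) => RR t π = R0 ∧ ¬ (π⁻¹ t : ℕ) < t) with hWD'
  set W1 := WS q (fun π : Equiv.Perm (Fin n) => (RR t π = R0 ∧ (π⁻¹ t : ℕ) < t) ∧ (π t : ℕ) < t + 1) with hW1
  set W2 := WS q (fun π : Equiv.Perm (Fin n) => (RR t π = R0 ∧ (π⁻¹ t : ℕ) < t) ∧ ¬ (π t : ℕ) < t + 1) with hW2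
  set W3 := WS q (fun π : Equiv.Perm (Fin n) => (RR t π = R0 ∧ ¬ (π⁻¹ t : ℕ) < t) ∧ (π t : ℕ) < t + 1) with hW3
  set W4 := WS q (fun π : Equiv.Perm (Fin n) => (RR t π = R0 ∧ ¬ (π⁻¹ t : ℕ) < t) ∧ ¬ (π t : ℕ) < t + 1) with hW4
  have s1 : WD + WD' = W := WS_split q _ _
  have s2 : W1 + W2 = WD := WS_split q _ _
  have s3 : W3 + W4 = WD' := WS_split q _ _
  have hmeas : ∀ π π' : Equiv.Perm (Fin n), (∀ r < t, π r = π' r) → (π⁻¹ t : ℕ) < t → (π'⁻¹ t : ℕ) < t := by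
    intro π π' h h1
    have := h (π⁻¹ t) h1
    have h2 : π'⁻¹ t = π⁻¹ t := by
      rw [Equiv.Perm.inv_eq_iff_eq, ← this]; simp
    rw [h2]; exact h1
  have m1 : qi q (n - t) * WD = qi q k * W := by
    refine WS_col q t (fun π => RR t π = R0) (fun π π' h h1 => by rw [← h1]; exact (RR_col _ _ _ h).symm) t k ?_
    intro π h
    rw [NN_self_inv, hk π h]
  have m2 : qi q (n - t) * W1 = qi q k * WD := by
    refine WS_row q t (fun π => RR t π = R0 ∧ (π⁻¹ t : ℕ) < t)
      (fun π π' h h1 => ⟨by rw [← h1.1]; exact (RR_row _ _ _ h).symm, hmeas _ _ h h1.2⟩) (t + 1) k ?_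
    rintro π ⟨h, h'⟩
    rw [NN_succ_col, hk π h, if_pos h', add_zero]
  have m3 : qi q (n - t) * W3 = qi q (k + 1) * WD' := by
    refine WS_row q t (fun π => RR t π = R0 ∧ ¬ (π⁻¹ t : ℕ) < t)
      (fun π π' h h1 => ⟨by rw [← h1.1]; exact (RR_row _ _ _ h).symm,
        fun h2 => h1.2 (hmeas _ _ (fun r hr => (h r hr).symm) h2)⟩) (t + 1) (k + 1) ?_
    rintro π ⟨h, h'⟩
    rw [NN_succ_col, hk π h, if_neg h']
  have hsum : (∑ π : Equiv.Perm (Fin n), if RR t π = R0 then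
        q ^ invCount n π * q⁻¹ ^ (NN (t + 1) (t + 1) π) else 0) =
      q⁻¹ ^ k * (q * W1 + W2 + W3 + q⁻¹ * W4) := by
    simp only [hW1, hW2, hW3, hW4, WS]
    simp only [mul_add, Finset.mul_sum]
    simp only [← Finset.sum_add_distrib]
    refine Finset.sum_congr rfl fun π _ => ?_
    by_cases h : RR t π = R0
    · have c1 := NN_succ_col t π
      have c2 := NN_succ_row t (t + 1) π
      rw [hk π h] at c1
      rw [c1] at c2
      by_cases hD : (π⁻¹ t : ℕ) < t <;> by_cases hI : (π t : ℕ) < t + 1 <;>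
        simp only [h, hD, hI, if_true, if_false, and_self, and_true, and_false, true_and, false_and,
          not_true, not_false_eq_true, mul_zero, add_zero, zero_add] at c2 ⊢
      · rw [c2, pow_succ]; field_simp
      · rw [← c2]; ring
      · rw [← Nat.add_right_cancel c2]; ring
      · rw [← c2, pow_succ]; ring
    · simp [h]
  rw [hsum]
  have hM := qi_pos q hq (n - t) (by have := t.2; omega)
  have hMg := qi_geom q (n - t)
  have hkg := qi_geom q k
  have hks : qi q (k + 1) = 1 + q * qi q k := by rw [qi_succ]; linarith
  have hD'0 : 0 ≤ WD' := WS_nonneg q hq _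
  have hW0 : 0 ≤ W := WS_nonneg q hq _
  set M := qi q (n - t)
  have hk0 := qi_nonneg q hq k
  set α := qi q k / M with hα
  set β := qi q (k + 1) / M with hβ
  have hα0 : 0 ≤ α := by positivity
  have a1 : WD = α * W := by rw [hα]; field_simp; linarith
  have a2 : W1 = α * WD := by rw [hα]; field_simp; linarith
  have a3 : W3 = β * WD' := by rw [hβ]; field_simp; linarith
  have hy : 0 < q ^ (n - (t : ℕ)) := by positivity
  have hMle : (1 - q) * M ≤ 1 := by rw [hMg]; linarith
  have hβα : 1 - β ≤ q * (1 - α) := by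
    have : β - q * α = 1 / M := by rw [hα, hβ, hks]; field_simp; ring
    have h2 : 1 - q ≤ 1 / M := by rw [le_div_iff₀ hM]; exact hMle
    linarith
  have hαx : 1 - q ^ k ≤ α := by
    have : α * M = qi q k := by rw [hα]; field_simp
    calc 1 - q ^ k = α * ((1 - q) * M) := by rw [← hkg, ← this]; ring
      _ ≤ α * 1 := mul_le_mul_of_nonneg_left hMle hα0
      _ = α := mul_one _
  have hX : 0 < q⁻¹ ^ k := by positivity
  have hXx : q⁻¹ ^ k * q ^ k = 1 := by rw [← mul_pow, inv_mul_cancel₀ hq.ne', one_pow]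
  have key : q * W1 + W2 + W3 + q⁻¹ * W4 ≤ W * (1 + (1 - q) * (2 * q ^ k - 1)) := by
    have e2 : W2 = WD - α * WD := by rw [← a2]; linarith
    have e4 : W4 = (1 - β) * WD' := by linarith
    have h4 : q⁻¹ * W4 ≤ W4 + (1 - q) * ((1 - α) * WD') := by
      have h5 : q⁻¹ * (1 - β) ≤ 1 - α := by
        rw [inv_mul_le_iff₀ hq]; exact hβα
      have h6 : q⁻¹ * W4 = W4 + (1 - q) * (q⁻¹ * (1 - β) * WD') := by
        rw [e4]; field_simp; ring
      rw [h6]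
      have := mul_le_mul_of_nonneg_right h5 hD'0
      have := mul_le_mul_of_nonneg_left this (by linarith : 0 ≤ 1 - q)
      linarith
    have e5 : WD' = (1 - α) * W := by linarith
    have h7 : 0 ≤ (1 - q) * W * (2 * (α - (1 - q ^ k))) := by
      apply mul_nonneg (mul_nonneg (by linarith) hW0); linarith
    have : q * W1 + W2 + W3 + q⁻¹ * W4 ≤ q * (α * WD) + (WD - α * WD) + WD' + (1 - q) * ((1 - α) * WD') := by
      rw [a2, e2]; linarith
    refine this.trans ?_
    rw [e5, a1]
    nlinarith [h7]
  calc q⁻¹ ^ k * (q * W1 + W2 + W3 + q⁻¹ * W4) ≤ q⁻¹ ^ k * (W * (1 + (1 - q) * (2 * q ^ k - 1))) :=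
        mul_le_mul_of_nonneg_left key hX.le
    _ = W * (q⁻¹ ^ k + (1 - q) * (2 - q⁻¹ ^ k)) := by
        linear_combination (2 * W * (1 - q)) * hXx

lemma sum_fiber {n : ℕ} (t : ℕ) (f : Equiv.Perm (Fin n) → ℝ) :
    ∑ π, f π = ∑ R0 : Fin n → Fin n → Prop, ∑ π : Equiv.Perm (Fin n),
      if RR t π = R0 then f π else 0 := by
  rw [Finset.sum_comm]
  refine Finset.sum_congr rfl fun π _ => ?_
  rw [Finset.sum_ite_eq]
  simp

def MM {n : ℕ} (q : ℝ) (t : ℕ) : ℝ :=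
  ∑ π : Equiv.Perm (Fin n), q ^ invCount n π * q⁻¹ ^ (NN t t π)

lemma WS_fib_mul {n : ℕ} (q c : ℝ) (t : ℕ) (R0 : Fin n → Fin n → Prop) :
    WS q (fun π : Equiv.Perm (Fin n) => RR t π = R0) * c =
      ∑ π : Equiv.Perm (Fin n), if RR t π = R0 then q ^ invCount n π * c else 0 := by
  unfold WS
  rw [Finset.sum_mul]
  refine Finset.sum_congr rfl fun π _ => ?_
  split_ifs <;> simp

lemma MM_step {n : ℕ} (q : ℝ) (hq : 0 < q) (hq1 : q < 1) (t : Fin n) :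
    MM (n := n) q (t + 1) ≤ q * MM (n := n) q t + 2 * (1 - q) * mallowsZ n q := by
  have : q * MM (n := n) q t + 2 * (1 - q) * mallowsZ n q =
     ∑ π : Equiv.Perm (Fin n), q ^ invCount n π *
       (q⁻¹ ^ (NN t t π) + (1 - q) * (2 - q⁻¹ ^ (NN t t π))) := by
    unfold MM mallowsZ
    rw [Finset.mul_sum, Finset.mul_sum, ← Finset.sum_add_distrib]
    refine Finset.sum_congr rfl fun π _ => ?_
    ring
  rw [this, sum_fiber t, MM, sum_fiber t]
  refine Finset.sum_le_sum fun R0 _ => ?_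
  refine (drift q hq hq1 t R0 (openCol R0 t) (fun π h => by rw [NN_eq _ _ le_rfl, h])).trans ?_
  rw [WS_fib_mul]
  refine Finset.sum_le_sum fun π _ => ?_
  split_ifs with h
  · rw [NN_eq _ _ le_rfl, h]
  · exact le_rfl

lemma Z_pos {n : ℕ} (q : ℝ) (hq : 0 < q) : 0 < mallowsZ n q := by
  unfold mallowsZ
  apply Finset.sum_pos
  · intro i _; positivity
  · exact univ_nonempty

lemma MM_le {n : ℕ} (q : ℝ) (hq : 0 < q) (hq1 : q < 1) (t : ℕ) (ht : t ≤ n) :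
    MM (n := n) q t ≤ 2 * mallowsZ n q := by
  induction t with
  | zero =>
    have : MM (n := n) q 0 = mallowsZ n q := by
      unfold MM mallowsZ
      refine Finset.sum_congr rfl fun π _ => ?_
      simp [NN]
    rw [this]
    have := Z_pos (n := n) q hq
    linarith
  | succ t ih =>
    have h1 := MM_step q hq hq1 (⟨t, ht⟩ : Fin n)
    have h2 := ih (by omega)
    simp only at h1
    nlinarith

def SS {n : ℕ} (q : ℝ) (s : Fin n) (t : ℕ) : ℝ :=
  ∑ π : Equiv.Perm (Fin n), if Alive s t π then
    q ^ invCount n π * (1 + (1 - q) / 64 * (q * q⁻¹ ^ (NN t t π))) else 0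

lemma alive_mono {n : ℕ} (s : Fin n) (t : ℕ) (π : Equiv.Perm (Fin n)) (h : Alive s (t + 1) π) :
    Alive s t π := by
  obtain ⟨u, hu, h⟩ := h
  exact ⟨u, hu, by omega⟩

lemma numeric (d q X Y : ℝ) (hd0 : 0 < d) (hd1 : d < 1) (hq : q < 1) (hX : 0 < X) (hX1 : X ≤ 1)
    (hXY : X * Y = 1) :
    1 + d / 64 * (Y + d * (2 * q - Y)) - d ^ 2 * X ^ 2 ≤ (1 - d ^ 2 / 64) * (1 + d / 64 * Y) := by
  have hY : 1 ≤ Y := by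
    by_contra h
    push Not at h
    nlinarith
  have h1 : 0 ≤ 64 * X ^ 2 + Y - 2 - (64 + Y) / 64 := by
    have : (64 * X ^ 2 + Y - 2 - (64 + Y) / 64) * X = 64 * X ^ 3 + 63 / 64 - 3 * X := by
      linear_combination (63 / 64) * hXY
    have h2 : 0 ≤ 64 * X ^ 3 + 63 / 64 - 3 * X := by
      nlinarith [mul_nonneg hX.le (sq_nonneg (X - 1 / 8)), sq_nonneg (X - 1 / 8)]
    by_contra h
    push Not at h
    nlinarith
  have h3 : 0 ≤ d ^ 2 / 64 * (64 * X ^ 2 + Y - 2 * q - (64 + d * Y) / 64) := by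
    apply mul_nonneg (by positivity)
    nlinarith
  nlinarith [h3]

lemma SS_step {n : ℕ} (q : ℝ) (hq : 0 < q) (hq1 : q < 1) (s t : Fin n) (hst : (s : ℕ) < t) :
    SS q s (t + 1) ≤ (1 - (1 - q) ^ 2 / 64) * SS q s t := by
  have hr : 0 ≤ 1 - (1 - q) ^ 2 / 64 := by nlinarith
  unfold SS
  rw [sum_fiber t, sum_fiber (t : ℕ) (fun π => if Alive s t π then _ else 0), Finset.mul_sum]
  refine Finset.sum_le_sum fun R0 _ => ?_
  by_cases hA : ∃ π0, RR t π0 = R0 ∧ Alive s t π0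
  swap
  · push Not at hA
    have z1 : ∀ π, (if RR t π = R0 then if Alive s (t + 1) π then
        q ^ invCount n π * (1 + (1 - q) / 64 * (q * q⁻¹ ^ (NN (t + 1) (t + 1) π))) else 0 else 0) = 0 := by
      intro π
      split_ifs with h1 h2
      · exact absurd (alive_mono _ _ _ h2) (hA π h1)
      · rfl
      · rfl
    rw [Finset.sum_congr rfl (fun π _ => z1 π)]
    rw [Finset.sum_const_zero]
    apply mul_nonneg hr
    apply Finset.sum_nonneg
    intro π _
    split_ifs with h1 h2
    · exact absurd h2 (hA π h1)
    · exact le_rfl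
    · exact le_rfl
  obtain ⟨π0, hR0, hA0⟩ := hA
  obtain ⟨a, ha, ha'⟩ := (alive_iff s t hst π0).1 hA0
  obtain ⟨b, hb, hb'⟩ := alive_back s t hst π0 hA0
  have hat := RTG_lt hst ha
  have hbt : (b : ℕ) < t := by
    rcases Relation.ReflTransGen.cases_head hb with h | ⟨c, h, _⟩
    · rw [h]; exact hst
    · exact h.1
  rw [hR0] at ha ha' hb hb'
  set k := openCol R0 t with hk
  have hkN : ∀ π : Equiv.Perm (Fin n), RR t π = R0 → NN t t π = k := fun π h => by
    rw [NN_eq _ _ le_rfl, h]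
  have hAll : ∀ π : Equiv.Perm (Fin n), RR t π = R0 → Alive s t π := fun π h => by
    rw [alive_iff s t hst, h]; exact ⟨a, ha, ha'⟩
  have hj : openCol R0 b + 1 ≤ k := by
    rw [← openCol_succ _ _ hb']; exact openCol_mono _ hbt
  have hi : openCol (fun x y => R0 y x) a + 1 ≤ k := by
    rw [← openCol_succ _ _ ha']
    refine (openCol_mono _ hat).trans ?_
    have := NN_inv_eq t t le_rfl π0
    rw [hR0] at this
    rw [← this, NN_self_inv, hkN π0 hR0]
  set W := WS q (fun π : Equiv.Perm (Fin n) => RR t π = R0) with hW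
  have hW0 : 0 ≤ W := WS_nonneg q hq _
  set WK := WS q (fun π => (RR t π = R0 ∧ π t = b) ∧ π⁻¹ t = a) with hWK
  have hkill : (1 - q) ^ 2 * (q ^ (k - 1)) ^ 2 * W ≤ WK := by
    have e := kill_weight q t R0 a b hat hbt ha' hb'
    have hM := qi_pos q hq (n - t) (by have := t.2; omega)
    have hMg := qi_geom q (n - t)
    have hy : 0 < q ^ (n - (t : ℕ)) := by positivity
    have hMle : (1 - q) * qi q (n - t) ≤ 1 := by rw [hMg]; linarith
    rw [← hW, ← hWK] at e
    set M := qi q (n - t)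
    have hp : (q ^ (k - 1)) ^ 2 ≤ q ^ (openCol R0 b + openCol (fun x y => R0 y x) a) := by
      rw [← pow_mul]
      exact pow_le_pow_of_le_one hq.le hq1.le (by omega)
    have h1 : (q ^ (k - 1)) ^ 2 * W ≤ M ^ 2 * WK := by
      rw [e]; exact mul_le_mul_of_nonneg_right hp hW0
    have hWK0 : 0 ≤ WK := WS_nonneg q hq _
    calc (1 - q) ^ 2 * (q ^ (k - 1)) ^ 2 * W = (1 - q) ^ 2 * ((q ^ (k - 1)) ^ 2 * W) := by ring
      _ ≤ (1 - q) ^ 2 * (M ^ 2 * WK) := mul_le_mul_of_nonneg_left h1 (sq_nonneg _)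
      _ = ((1 - q) * M) ^ 2 * WK := by ring
      _ ≤ 1 * WK := by
        apply mul_le_mul_of_nonneg_right _ hWK0
        apply pow_le_one₀ (mul_nonneg (by linarith) hM.le) hMle
      _ = WK := one_mul _
  have hdrift := drift q hq hq1 t R0 k hkN
  rw [← hW] at hdrift
  set DS := (∑ π : Equiv.Perm (Fin n), if RR t π = R0 then
        q ^ invCount n π * q⁻¹ ^ (NN (t + 1) (t + 1) π) else 0) with hDS
  have step1 : (∑ π, (if RR t π = R0 then if Alive s (t + 1) π then
        q ^ invCount n π * (1 + (1 - q) / 64 * (q * q⁻¹ ^ (NN (t + 1) (t + 1) π))) else 0 else 0))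
      ≤ W + (1 - q) / 64 * q * DS - WK := by
    rw [hW, hDS, hWK, WS, WS, Finset.mul_sum, ← Finset.sum_add_distrib, ← Finset.sum_sub_distrib]
    refine Finset.sum_le_sum fun π _ => ?_
    have hw : 0 < q ^ invCount n π := by positivity
    have hw' : 0 ≤ (1 - q) / 64 * q * (q ^ invCount n π * q⁻¹ ^ (NN (t + 1) (t + 1) π)) := by
      have : 0 < 1 - q := by linarith
      positivity
    by_cases h : RR t π = R0
    · by_cases hK : π t = b ∧ π⁻¹ t = a
      · have hna : ¬ Alive s (t + 1) π := by
          refine kill s t hst π a b ?_ ?_ ?_ hK.1 ?_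
          · rw [h]; exact ha
          · rw [h]; exact ha'
          · rw [h]; exact hb
          · rw [← hK.2]; simp
        simp only [h, hna, if_true, if_false]
        rw [if_pos ⟨⟨trivial, hK.1⟩, hK.2⟩]
        linarith
      · have hK' : ¬ ((RR t π = R0 ∧ π t = b) ∧ π⁻¹ t = a) := fun h' => hK ⟨h'.1.2, h'.2⟩
        rw [if_neg hK']
        simp only [h, if_true]
        split_ifs
        · linarith
        · linarith
    · simp [h]
  have step2 : (∑ π, (if RR t π = R0 then if Alive s t π then
        q ^ invCount n π * (1 + (1 - q) / 64 * (q * q⁻¹ ^ (NN t t π))) else 0 else 0))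
      = W * (1 + (1 - q) / 64 * (q * q⁻¹ ^ k)) := by
    rw [hW, WS_fib_mul]
    refine Finset.sum_congr rfl fun π _ => ?_
    split_ifs with h1 h2
    · rw [hkN π h1]
    · exact absurd (hAll π h1) h2
    · rfl
  rw [step2]
  refine step1.trans ?_
  have hd : 0 < 1 - q := by linarith
  have hc : 0 ≤ (1 - q) / 64 * q := by positivity
  have h5 := mul_le_mul_of_nonneg_left hdrift hc
  have hYX : q ^ (k - 1) * (q * q⁻¹ ^ k) = 1 := by
    rw [← mul_assoc, ← pow_succ, Nat.sub_add_cancel (by omega), ← mul_pow, mul_inv_cancel₀ hq.ne', one_pow]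
  have hnum := numeric (1 - q) q (q ^ (k - 1)) (q * q⁻¹ ^ k) hd (by linarith) hq1 (by positivity)
    (pow_le_one₀ hq.le hq1.le) hYX
  have h6 := mul_le_mul_of_nonneg_left hnum hW0
  nlinarith [h5, h6, hkill]

lemma alive_K {n : ℕ} (s : Fin n) (t : ℕ) (hst : (s : ℕ) < t) (π : Equiv.Perm (Fin n)) (h : Alive s t π) :
    1 ≤ NN t t π := by
  obtain ⟨b, hb, hb'⟩ := alive_back s t hst π h
  have hbt : (b : ℕ) < t := by
    rcases Relation.ReflTransGen.cases_head hb with h | ⟨c, h, _⟩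
    · rw [h]; exact hst
    · exact h.1
  rw [NN_eq _ _ le_rfl]
  have := openCol_mono (RR t π) (v := b + 1) (w := t) hbt
  rw [openCol_succ _ _ hb'] at this
  omega

lemma SS_init {n : ℕ} (q : ℝ) (hq : 0 < q) (hq1 : q < 1) (s : Fin n) :
    SS q s (s + 1) ≤ 4 * q * mallowsZ n q := by
  have h1 : SS q s (s + 1) ≤ 2 * q * MM (n := n) q (s + 1) := by
    unfold SS MM
    rw [Finset.mul_sum]
    refine Finset.sum_le_sum fun π _ => ?_
    have hw : 0 < q ^ invCount n π := by positivity
    split_ifs with h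
    · have hk := alive_K s (s + 1) (by omega) π h
      set k := NN (s + 1) (s + 1) π
      have h2 : 1 ≤ q * q⁻¹ ^ k := by
        obtain ⟨j, hj⟩ : ∃ j, k = j + 1 := ⟨k - 1, by omega⟩
        rw [hj, pow_succ']
        rw [← mul_assoc, mul_inv_cancel₀ hq.ne', one_mul]
        exact one_le_pow₀ ((one_le_inv₀ hq).2 hq1.le)
      have : 1 + (1 - q) / 64 * (q * q⁻¹ ^ k) ≤ 2 * (q * q⁻¹ ^ k) := by nlinarith
      have := mul_le_mul_of_nonneg_left this hw.le
      linarith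
    · positivity
  have h2 := MM_le (n := n) q hq hq1 (s + 1) s.2
  have := mul_le_mul_of_nonneg_left h2 (by positivity : 0 ≤ 2 * q)
  linarith

lemma SS_bound {n : ℕ} (q : ℝ) (hq : 0 < q) (hq1 : q < 1) (s : Fin n) (j : ℕ) (hj : s + 1 + j ≤ n) :
    SS q s (s + 1 + j) ≤ 4 * q * mallowsZ n q * (1 - (1 - q) ^ 2 / 64) ^ j := by
  have hr : 0 ≤ 1 - (1 - q) ^ 2 / 64 := by nlinarith
  induction j with
  | zero => simpa using SS_init q hq hq1 s
  | succ j ih =>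
    have h1 := SS_step q hq hq1 s (⟨s + 1 + j, by omega⟩ : Fin n) (by simp; omega)
    have h2 := mul_le_mul_of_nonneg_left (ih (by omega)) hr
    rw [pow_succ]
    simp only at h1
    have e : (s : ℕ) + 1 + (j + 1) = s + 1 + j + 1 := by ring
    rw [e]
    linarith

lemma tail_bound {n : ℕ} (q : ℝ) (hq : 0 < q) (hq1 : q < 1) (s : Fin n) (j : ℕ) :
    WS q (Alive s (s + 1 + j)) ≤ 4 * q * mallowsZ n q * (1 - (1 - q) ^ 2 / 64) ^ j := by
  by_cases hj : s + 1 + j ≤ n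
  · refine le_trans ?_ (SS_bound q hq hq1 s j hj)
    unfold WS SS
    refine Finset.sum_le_sum fun π _ => ?_
    split_ifs with h
    · have : 0 < 1 - q := by linarith
      apply le_mul_of_one_le_right (by positivity)
      have : 0 ≤ (1 - q) / 64 * (q * q⁻¹ ^ NN (s + 1 + j) (s + 1 + j) π) := by positivity
      linarith
    · exact le_rfl
  · have : ∀ π : Equiv.Perm (Fin n), ¬ Alive s (s + 1 + j) π := by
      rintro π ⟨u, _, hu⟩
      have := u.2
      omega
    simp only [WS, this, if_false, Finset.sum_const_zero]
    have hr : 0 ≤ 1 - (1 - q) ^ 2 / 64 := by nlinarith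
    have := Z_pos (n := n) q hq
    positivity

lemma geom_bound (r : ℝ) (h0 : 0 ≤ r) (h1 : r < 1) (N : ℕ) :
    ∑ j ∈ range N, (2 * (j : ℝ) + 1) * r ^ j ≤ 2 / (1 - r) ^ 2 := by
  have e : (1 - r) ^ 2 * ∑ j ∈ range N, ((j : ℝ) + 1) * r ^ j = 1 - (N + 1) * r ^ N + N * r ^ (N + 1) := by
    induction N with
    | zero => simp
    | succ N ih => rw [Finset.sum_range_succ, mul_add, ih]; push_cast; ring
  have hp : 0 < (1 - r) ^ 2 := by have : 0 < 1 - r := by linarith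
                                  positivity
  rw [le_div_iff₀ hp]
  have h2 : ∑ j ∈ range N, (2 * (j : ℝ) + 1) * r ^ j ≤ 2 * ∑ j ∈ range N, ((j : ℝ) + 1) * r ^ j := by
    rw [Finset.mul_sum]
    refine Finset.sum_le_sum fun j _ => ?_
    have : 0 ≤ r ^ j := by positivity
    nlinarith
  have h3 : (N : ℝ) * r ^ (N + 1) ≤ (N + 1) * r ^ N := by
    have : 0 ≤ r ^ N := by positivity
    have h5 : r ^ (N + 1) ≤ r ^ N := pow_le_pow_of_le_one h0 h1.le (by omega)
    have : (0 : ℝ) ≤ N := by positivity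
    nlinarith
  nlinarith

lemma cycMax_ge {n : ℕ} (π : Equiv.Perm (Fin n)) (s : Fin n) : (s : ℕ) + 1 ≤ cycMax n π s :=
  Finset.le_sup (f := fun t : Fin n => (t : ℕ) + 1) (self_mem_cycleSet n π s)

lemma cycMax_le {n : ℕ} (π : Equiv.Perm (Fin n)) (s : Fin n) : cycMax n π s ≤ n :=
  Finset.sup_le fun t _ => t.2

lemma cycMax_alive {n : ℕ} (π : Equiv.Perm (Fin n)) (s : Fin n) (t : ℕ) :
    t < cycMax n π s ↔ Alive s t π := by
  unfold cycMax Alive cycleSet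
  rw [Finset.lt_sup_iff]
  simp [Nat.lt_succ_iff]

lemma sq_sum (T N : ℕ) (h : T ≤ N) :
    (T : ℝ) ^ 2 = ∑ j ∈ range N, if j < T then (2 * (j : ℝ) + 1) else 0 := by
  rw [← Finset.sum_filter]
  have : (range N).filter (fun j => j < T) = range T := by
    ext j; simp; omega
  rw [this]
  clear h this
  induction T with
  | zero => simp
  | succ T ih => rw [Finset.sum_range_succ, ← ih]; push_cast; ring

lemma second_moment {n : ℕ} (q : ℝ) (hq : 0 < q) (hq1 : q < 1) (s : Fin n) :
    mExp n q (fun π => ((cycMax n π s : ℝ) - (((s : ℕ) : ℝ) + 1)) ^ 2) ≤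
      32768 * q / (1 - q) ^ 4 := by
  have hZ := Z_pos (n := n) q hq
  have hr : 0 ≤ 1 - (1 - q) ^ 2 / 64 := by nlinarith
  have hd : 0 < 1 - q := by linarith
  have e : mExp n q (fun π => ((cycMax n π s : ℝ) - (((s : ℕ) : ℝ) + 1)) ^ 2) =
      (∑ j ∈ range n, (2 * (j : ℝ) + 1) * WS q (Alive s (s + 1 + j))) / mallowsZ n q := by
    unfold mExp mallowsP WS
    simp only [Finset.mul_sum]
    rw [Finset.sum_comm, Finset.sum_div]
    refine Finset.sum_congr rfl fun π _ => ?_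
    have h1 := cycMax_ge π s
    have h2 := cycMax_le π s
    have h3 : (cycMax n π s : ℝ) - (((s : ℕ) : ℝ) + 1) = ((cycMax n π s - (s + 1) : ℕ) : ℝ) := by
      rw [Nat.cast_sub h1]; push_cast; ring
    rw [h3, sq_sum _ n (by omega), div_mul_eq_mul_div, Finset.mul_sum]
    congr 1
    refine Finset.sum_congr rfl fun j _ => ?_
    have : j < cycMax n π s - (s + 1) ↔ Alive s (s + 1 + j) π := by
      rw [← cycMax_alive]; omega
    by_cases h : Alive s (s + 1 + j) π
    · rw [if_pos (this.2 h), if_pos h]; ring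
    · rw [if_neg (fun h' => h (this.1 h')), if_neg h]; ring
  rw [e, div_le_iff₀ hZ]
  calc ∑ j ∈ range n, (2 * (j : ℝ) + 1) * WS q (Alive s (s + 1 + j))
      ≤ ∑ j ∈ range n, (2 * (j : ℝ) + 1) * (4 * q * mallowsZ n q * (1 - (1 - q) ^ 2 / 64) ^ j) := by
        refine Finset.sum_le_sum fun j _ => ?_
        exact mul_le_mul_of_nonneg_left (tail_bound q hq hq1 s j) (by positivity)
    _ = 4 * q * mallowsZ n q * ∑ j ∈ range n, (2 * (j : ℝ) + 1) * (1 - (1 - q) ^ 2 / 64) ^ j := by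
        rw [Finset.mul_sum]
        refine Finset.sum_congr rfl fun j _ => ?_
        ring
    _ ≤ 4 * q * mallowsZ n q * (2 / (1 - (1 - (1 - q) ^ 2 / 64)) ^ 2) := by
        apply mul_le_mul_of_nonneg_left _ (by positivity)
        apply geom_bound _ hr
        have : 0 < (1 - q) ^ 2 := by positivity
        linarith
    _ = 32768 * q / (1 - q) ^ 4 * mallowsZ n q := by
        have : (1 - (1 - (1 - q) ^ 2 / 64)) = (1 - q) ^ 2 / 64 := by ring
        rw [this]
        field_simp
        ring

lemma trivial_bound {n : ℕ} (q : ℝ) (hq : 0 < q) (s : Fin n) :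
    mExp n q (fun π => ((cycMax n π s : ℝ) - (((s : ℕ) : ℝ) + 1)) ^ 2) ≤
      ((n : ℝ) - (((s : ℕ) : ℝ) + 1)) ^ 2 := by
  have hZ := Z_pos (n := n) q hq
  calc mExp n q (fun π => ((cycMax n π s : ℝ) - (((s : ℕ) : ℝ) + 1)) ^ 2)
      ≤ ∑ π : Equiv.Perm (Fin n), mallowsP n q π * ((n : ℝ) - (((s : ℕ) : ℝ) + 1)) ^ 2 := by
        unfold mExp
        refine Finset.sum_le_sum fun π _ => ?_
        apply mul_le_mul_of_nonneg_left
        · have h1 : ((s : ℕ) : ℝ) + 1 ≤ cycMax n π s := by exact_mod_cast cycMax_ge π s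
          have h2 : (cycMax n π s : ℝ) ≤ n := by exact_mod_cast cycMax_le π s
          apply pow_le_pow_left₀ <;> linarith
        · unfold mallowsP; positivity
    _ = ((n : ℝ) - (((s : ℕ) : ℝ) + 1)) ^ 2 := by
        rw [← Finset.sum_mul]
        unfold mallowsP
        rw [← Finset.sum_div]
        change mallowsZ n q / mallowsZ n q * _ = _
        rw [div_self hZ.ne', one_mul]

lemma xi_bound (q : ℝ) (hq : 0 < q) (hq1 : q < 1) :
    1 / (1 - q) ≤ 2 * ((sInf {i : ℕ | 0 < i ∧ q ^ i ≤ 1 / 2} : ℕ) : ℝ) := by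
  have hne : {i : ℕ | 0 < i ∧ q ^ i ≤ 1 / 2}.Nonempty := by
    obtain ⟨i, hi⟩ := exists_pow_lt_of_lt_one (by norm_num : (0 : ℝ) < 1 / 2) hq1
    refine ⟨i, ?_, hi.le⟩
    rcases Nat.eq_zero_or_pos i with h | h
    · subst h; norm_num at hi
    · exact h
  have hmem := Nat.sInf_mem hne
  set ξ := sInf {i : ℕ | 0 < i ∧ q ^ i ≤ 1 / 2}
  have h1 := one_add_mul_le_pow (by linarith : (-2 : ℝ) ≤ q - 1) ξ
  have h2 : q ^ ξ ≤ 1 / 2 := hmem.2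
  have h3 : (1 : ℝ) + (q - 1) = q := by ring
  rw [h3] at h1
  rw [div_le_iff₀ (by linarith)]
  linarith

theorem mallows_cycle_max_second_moment :
    ∃ C : ℝ, 0 < C ∧
      ∀ (n : ℕ) (q : ℝ), 1 ≤ n → 0 < q → q < 1 → ∀ s : Fin n,
        mExp n q (fun π => ((cycMax n π s : ℝ) - (((s : ℕ) : ℝ) + 1)) ^ 2)
          ≤ C * min (q * ((sInf {i : ℕ | 0 < i ∧ q ^ i ≤ 1 / 2} : ℕ) : ℝ) ^ 4)
              (((n : ℝ) - (((s : ℕ) : ℝ) + 1)) ^ 2) := by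
  refine ⟨524288, by norm_num, ?_⟩
  intro n q _ hq hq1 s
  rw [mul_min_of_nonneg _ _ (by norm_num)]
  refine le_min ?_ ?_
  · refine (second_moment q hq hq1 s).trans ?_
    have h := xi_bound q hq hq1
    have hd : 0 < 1 - q := by linarith
    have h4 := pow_le_pow_left₀ (by positivity) h 4
    have e : 32768 * q / (1 - q) ^ 4 = 32768 * q * (1 / (1 - q)) ^ 4 := by
      rw [one_div, inv_pow]; rfl
    rw [e]
    have := mul_le_mul_of_nonneg_left h4 (by positivity : 0 ≤ 32768 * q)
    rw [mul_pow] at this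
    linarith
  · refine (trivial_bound q hq s).trans ?_
    have := sq_nonneg ((n : ℝ) - (((s : ℕ) : ℝ) + 1))
    linarith
end
end

section
/- There exists an absolute constant C > 0 such that the following holds. Let I be a nonempty finite set and, on some probability space, let Π be a random partition of I (a random variable taking values in the finite set of partitions of I into nonempty disjoint blocks with union I). For each i ∈ I let ℓ_i denote the cardinality of the block of Π containing i. Then ((1/|I|)·E[max_{i∈I} ℓ_i])³ ≤ C · (1/|I|)·max_{i∈I} E[ℓ_i]. -/
open Finset
open scoped BigOperators

theorem sq_max_le_sum {I : Type} [Fintype I] [DecidableEq I] [Nonempty I]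
    (P : Finpartition (Finset.univ : Finset I)) :
    (((Finset.univ.sup (fun i : I => (P.part i).card) : ℕ) : ℝ)) ^ 2
      ≤ ∑ i : I, ((P.part i).card : ℝ) := by
  obtain ⟨j, -, hj⟩ := Finset.exists_mem_eq_sup (Finset.univ : Finset I) Finset.univ_nonempty
    (fun i : I => (P.part i).card)
  rw [hj]
  calc ((P.part j).card : ℝ) ^ 2 = ∑ i ∈ P.part j, ((P.part i).card : ℝ) := by
        rw [Finset.sum_congr rfl (g := fun _ => ((P.part j).card : ℝ))]
        · simp [sq]
        · intro i hi
          rw [P.part_eq_of_mem (P.part_mem.2 (Finset.mem_univ j)) hi]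
    _ ≤ _ := Finset.sum_le_sum_of_subset_of_nonneg (Finset.subset_univ _)
        (fun _ _ _ => by positivity)

/-- There is an absolute constant `C > 0` such that for any random partition `Part`
of a nonempty finite set `I` (modelled on a finite probability space `Ω` with weights
`p`), writing `ℓ_i(ω)` for the size of the block of `Part ω` containing `i`, one has
`((1/|I|)·E[max_i ℓ_i])³ ≤ C · (1/|I|)·max_i E[ℓ_i]`. -/
theorem random_partition_max_block_bound :
    ∃ C : ℝ, 0 < C ∧
      ∀ (I : Type) [Fintype I] [DecidableEq I] [Nonempty I]
        (Ω : Type) [Fintype Ω] (p : Ω → ℝ),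
        (∀ ω, 0 ≤ p ω) → (∑ ω : Ω, p ω = 1) →
        ∀ Part : Ω → Finpartition (Finset.univ : Finset I),
          ((Fintype.card I : ℝ)⁻¹ *
              ∑ ω : Ω, p ω *
                ((Finset.univ.sup (fun i : I => ((Part ω).part i).card) : ℕ) : ℝ)) ^ 3
            ≤ C * ((Fintype.card I : ℝ)⁻¹ *
                (Finset.univ.sup' Finset.univ_nonempty
                  (fun i : I => ∑ ω : Ω, p ω * (((Part ω).part i).card : ℝ)))) := by
  refine ⟨1, one_pos, ?_⟩
  intro I _ _ _ Ω _ p hp hsum Part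
  set M : Ω → ℝ := fun ω =>
    ((Finset.univ.sup (fun i : I => ((Part ω).part i).card) : ℕ) : ℝ) with hM
  set S : ℝ := Finset.univ.sup' Finset.univ_nonempty
    (fun i : I => ∑ ω : Ω, p ω * (((Part ω).part i).card : ℝ)) with hS
  have hn : (0 : ℝ) < Fintype.card I := by exact_mod_cast Fintype.card_pos
  set n : ℝ := (Fintype.card I : ℝ) with hndef
  have hM0 : ∀ ω, 0 ≤ M ω := fun ω => by positivity
  have hMn : ∀ ω, M ω ≤ n := by
    intro ω
    have : Finset.univ.sup (fun i : I => ((Part ω).part i).card) ≤ Fintype.card I :=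
      Finset.sup_le fun i _ => Finset.card_le_univ _
    exact Nat.cast_le.2 this
  have h1 : ∑ ω, p ω * M ω ^ 2 ≤ n * S := by
    calc ∑ ω, p ω * M ω ^ 2 ≤ ∑ ω, p ω * ∑ i : I, (((Part ω).part i).card : ℝ) :=
          Finset.sum_le_sum fun ω _ =>
            mul_le_mul_of_nonneg_left (sq_max_le_sum (Part ω)) (hp ω)
      _ = ∑ i : I, ∑ ω, p ω * (((Part ω).part i).card : ℝ) := by
          simp_rw [Finset.mul_sum]
          exact Finset.sum_comm
      _ ≤ ∑ _i : I, S := Finset.sum_le_sum fun i hi =>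
          Finset.le_sup' (fun i : I => ∑ ω : Ω, p ω * (((Part ω).part i).card : ℝ)) hi
      _ = n * S := by simp [hndef]
  have h2 : (∑ ω, p ω * M ω) ^ 2 ≤ ∑ ω, p ω * M ω ^ 2 :=
    Real.pow_arith_mean_le_arith_mean_pow Finset.univ p M (fun i _ => hp i) hsum
      (fun i _ => hM0 i) 2
  have h0 : 0 ≤ ∑ ω, p ω * M ω := Finset.sum_nonneg fun ω _ => mul_nonneg (hp ω) (hM0 ω)
  have h3 : ∑ ω, p ω * M ω ≤ n := by
    calc ∑ ω, p ω * M ω ≤ ∑ ω, p ω * n :=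
          Finset.sum_le_sum fun ω _ => mul_le_mul_of_nonneg_left (hMn ω) (hp ω)
      _ = n := by rw [← Finset.sum_mul, hsum, one_mul]
  change (n⁻¹ * ∑ ω, p ω * M ω) ^ 3 ≤ 1 * (n⁻¹ * S)
  generalize (∑ ω, p ω * M ω) = m at *
  have ha : 0 ≤ n⁻¹ * m := by positivity
  have hb : n⁻¹ * m ≤ 1 := by
    rw [inv_mul_le_iff₀ hn]
    linarith
  calc (n⁻¹ * m) ^ 3 ≤ (n⁻¹ * m) ^ 2 := pow_le_pow_of_le_one ha hb (by norm_num)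
    _ = n⁻¹ ^ 2 * m ^ 2 := by ring
    _ ≤ n⁻¹ ^ 2 * (n * S) := mul_le_mul_of_nonneg_left (h2.trans h1) (by positivity)
    _ = 1 * (n⁻¹ * S) := by field_simp
end
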